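/- Let d ≥ 2 and let Ω ⊆ ℝ^d be an open set with nonempty complement. Let 0 < σ₋ < s < 1, 0 < p ≤ 1, 1 < q₋ ≤ 2, and suppose σ₋ − (d−1)/q₋ < s − (d−1)/p. Let 0 < h < 1 and C₀ > 0. Let x_0 ∈ Ω, set δ = d(x_0), and let Φ ∈ L²(ℝ^d) be supported in B(x_0, δ/2). Suppose F is a measurable function on Ω satisfying ‖F‖_{L^{q₋,σ₋}_{av}(Ω)} ≤ C₀ ‖Φ‖_{L^{q₋,σ₋}_{av}(Ω)}. Then ∫_{Γ_h(x_0)} |F(x)|^p d(x)^{p−1−ps} dx ≤ C ‖Φ‖_{L^{p,s}_{av}(Ω)}^p, where C depends only on d, h, p, s, q₋, σ₋ and C₀. (This is the content of the cone estimate of Lemma 2.5 of the paper: the only property of the solution u used there is the assumed norm bound ‖∇^m u‖_{L^{q₋,σ₋}_{av}(Ω)} ≤ C₀‖Φ‖_{L^{q₋,σ₋}_{av}(Ω)}.) -/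

import Mathlib

open MeasureTheory Metric Set ENNReal

noncomputable section

/-- `wdist Ω x = dist(x, ℝ^d ∖ Ω)`. -/
def wdist {d : ℕ} (Ω : Set (EuclideanSpace ℝ (Fin d))) (x : EuclideanSpace ℝ (Fin d)) : ℝ :=
  Metric.infDist x Ωᶜ

/-- The weighted averaged norm `‖H‖_{L^{q,σ}_{av}(Ω)}`. -/
def avNorm {d : ℕ} {F : Type*} [NormedAddCommGroup F] (q σ : ℝ)
    (Ω : Set (EuclideanSpace ℝ (Fin d))) (H : EuclideanSpace ℝ (Fin d) → F) : ℝ≥0∞ :=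
  (∫⁻ x in Ω,
      ((volume (Metric.ball x (wdist Ω x / 2)))⁻¹ *
          ∫⁻ y in Metric.ball x (wdist Ω x / 2), (‖H y‖₊ : ℝ≥0∞) ^ (2 : ℕ)) ^ (q / 2) *
        ENNReal.ofReal (wdist Ω x) ^ (q - 1 - q * σ)) ^ (1 / q)

/-- The nontangential cone `Γ_h(x₀) = {x ∈ Ω : |x₀ − x| < d(x)/h}`. -/
def cone {d : ℕ} (Ω : Set (EuclideanSpace ℝ (Fin d))) (h : ℝ) (x₀ : EuclideanSpace ℝ (Fin d)) :
    Set (EuclideanSpace ℝ (Fin d)) :=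
  {x ∈ Ω | dist x₀ x < wdist Ω x / h}

section Helpers

variable {d : ℕ} {Ω : Set (EuclideanSpace ℝ (Fin d))}

lemma ENNReal.rpow_le_rpow_of_le_of_nonpos {x y : ℝ≥0∞} (h : x ≤ y) {a : ℝ} (ha : a ≤ 0) :
    y ^ a ≤ x ^ a := by
  rw [← neg_neg a, ENNReal.rpow_neg, ENNReal.rpow_neg x]
  exact ENNReal.inv_le_inv.2 (ENNReal.rpow_le_rpow h (neg_nonneg.2 ha))

lemma ENNReal.rpow_le_of_comparable {K x y : ℝ≥0∞} (hK0 : K ≠ 0) (hy : y ≠ ⊤)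
    (hxy : x ≤ K * y) (hyx : y ≤ K * x) (a : ℝ) : x ^ a ≤ K ^ |a| * y ^ a := by
  rcases le_or_gt 0 a with ha | ha
  · rw [abs_of_nonneg ha, ← ENNReal.mul_rpow_of_nonneg _ _ ha]
    exact ENNReal.rpow_le_rpow hxy ha
  · have h1 : K⁻¹ * y ≤ x := by
      rw [mul_comm, ← div_eq_mul_inv]
      exact ENNReal.div_le_of_le_mul' hyx
    have h2 := ENNReal.rpow_le_rpow_of_le_of_nonpos h1 ha.le
    rwa [ENNReal.mul_rpow_of_ne_top (ENNReal.inv_ne_top.2 hK0) hy, ENNReal.inv_rpow,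
      ← ENNReal.rpow_neg, ← abs_of_neg ha] at h2

lemma wdist_pos (hΩ : IsOpen Ω) (hne : Ωᶜ.Nonempty) {x : EuclideanSpace ℝ (Fin d)}
    (hx : x ∈ Ω) : 0 < wdist Ω x :=
  ((isClosed_compl_iff.2 hΩ).notMem_iff_infDist_pos hne).1 (by simpa using hx)

lemma wdist_le_add_dist (x y : EuclideanSpace ℝ (Fin d)) :
    wdist Ω x ≤ wdist Ω y + dist x y :=
  Metric.infDist_le_infDist_add_dist

lemma mem_of_wdist_pos {x : EuclideanSpace ℝ (Fin d)} (hx : 0 < wdist Ω x) : x ∈ Ω := by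
  by_contra h
  have : wdist Ω x = 0 := Metric.infDist_zero_of_mem (by simpa using h)
  exact hx.ne' this

lemma wdist_nonneg {x : EuclideanSpace ℝ (Fin d)} : 0 ≤ wdist Ω x := Metric.infDist_nonneg

lemma continuous_wdist : Continuous (wdist Ω) := Metric.continuous_infDist_pt _

lemma volume_ball_mul (hd : d ≠ 0) (x y : EuclideanSpace ℝ (Fin d)) {c : ℝ} (hc : 0 ≤ c) (r : ℝ) :
    volume (ball x (c * r)) = ENNReal.ofReal c ^ d * volume (ball y r) := by
  have : Nonempty (Fin d) := ⟨⟨0, Nat.pos_of_ne_zero hd⟩⟩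
  rw [Measure.addHaar_ball_mul volume x hc, Measure.addHaar_ball_center volume y r,
    finrank_euclideanSpace_fin, ENNReal.ofReal_pow hc]

lemma measurable_inv_volume_ball (hd : d ≠ 0) :
    Measurable fun x : EuclideanSpace ℝ (Fin d) => (volume (ball x (wdist Ω x / 2)))⁻¹ := by
  have : (fun x : EuclideanSpace ℝ (Fin d) => (volume (ball x (wdist Ω x / 2)))⁻¹)
      = fun x => (ENNReal.ofReal (wdist Ω x / 2) ^ d *
          volume (ball (0 : EuclideanSpace ℝ (Fin d)) 1))⁻¹ := by
    ext x
    rw [← volume_ball_mul hd x 0 (div_nonneg wdist_nonneg zero_le_two), mul_one]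
  rw [this]
  have := (continuous_wdist (Ω := Ω)).measurable
  fun_prop

lemma setLIntegral_ball_eq (G : EuclideanSpace ℝ (Fin d) → ℝ≥0∞) (x : EuclideanSpace ℝ (Fin d)) :
    ∫⁻ y in ball x (wdist Ω x / 2), G y
      = ∫⁻ y, {z : EuclideanSpace ℝ (Fin d) × EuclideanSpace ℝ (Fin d) |
          dist z.2 z.1 < wdist Ω z.1 / 2}.indicator (fun z => G z.2) (x, y) := by
  rw [← lintegral_indicator measurableSet_ball]
  rfl

lemma measurable_indicator_ball {G : EuclideanSpace ℝ (Fin d) → ℝ≥0∞} (hG : Measurable G) :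
    Measurable ({z : EuclideanSpace ℝ (Fin d) × EuclideanSpace ℝ (Fin d) |
          dist z.2 z.1 < wdist Ω z.1 / 2}.indicator (fun z => G z.2)) := by
  refine (hG.comp measurable_snd).indicator (IsOpen.measurableSet ?_)
  have := continuous_wdist (Ω := Ω)
  exact isOpen_lt (by fun_prop) (by fun_prop)

/-- Integrating Whitney averages of `G` recovers, up to a constant, the integral of `G`. -/
lemma lintegral_le_lintegral_average (hd : d ≠ 0) (hΩ : IsOpen Ω) (hne : Ωᶜ.Nonempty)
    {G : EuclideanSpace ℝ (Fin d) → ℝ≥0∞} (hG : Measurable G) :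
    ∫⁻ y in Ω, G y ≤ 2 ^ d * ∫⁻ x in Ω, (volume (ball x (wdist Ω x / 2)))⁻¹ *
      ∫⁻ y in ball x (wdist Ω x / 2), G y := by
  have hV := measurable_inv_volume_ball (Ω := Ω) hd
  have hswap : ∫⁻ x in Ω, (volume (ball x (wdist Ω x / 2)))⁻¹ *
      ∫⁻ y in ball x (wdist Ω x / 2), G y = ∫⁻ y, ∫⁻ x in Ω,
        (volume (ball x (wdist Ω x / 2)))⁻¹ *
          {z : EuclideanSpace ℝ (Fin d) × EuclideanSpace ℝ (Fin d) |
            dist z.2 z.1 < wdist Ω z.1 / 2}.indicator (fun z => G z.2) (x, y) := by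
    rw [← lintegral_lintegral_swap]
    · refine lintegral_congr fun x => ?_
      rw [setLIntegral_ball_eq, lintegral_const_mul]
      exact (measurable_indicator_ball hG).comp measurable_prodMk_left
    · exact ((hV.comp measurable_fst).mul (measurable_indicator_ball hG)).aemeasurable
  rw [hswap, ← lintegral_const_mul' _ _ (by simp)]
  refine le_trans ?_ (setLIntegral_le_lintegral Ω _)
  refine setLIntegral_mono' hΩ.measurableSet fun y hy => ?_
  have hdy := wdist_pos hΩ hne hy
  have hsub : ball y (wdist Ω y / 3) ⊆ Ω := fun x hx => by
    refine mem_of_wdist_pos ?_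
    have := wdist_le_add_dist (Ω := Ω) y x
    rw [mem_ball, dist_comm] at hx
    linarith
  have hvol := volume_ball_mul hd y y zero_le_two (wdist Ω y / 3)
  have hpos : volume (ball y (wdist Ω y / 3)) ≠ 0 := (measure_ball_pos _ _ (by positivity)).ne'
  have htop : volume (ball y (wdist Ω y / 3)) ≠ ⊤ := measure_ball_lt_top.ne
  have h2 : (2 : ℝ≥0∞) ^ d ≠ 0 := by simp
  have h2' : (2 : ℝ≥0∞) ^ d ≠ ⊤ := by simp
  calc G y = 2 ^ d * ∫⁻ x in ball y (wdist Ω y / 3),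
        (volume (ball y (2 * (wdist Ω y / 3))))⁻¹ * G y := by
        rw [setLIntegral_const, hvol, ENNReal.ofReal_ofNat, ENNReal.mul_inv (.inl h2) (.inl h2')]
        calc G y = (2 ^ d * (2 ^ d)⁻¹) * ((volume (ball y (wdist Ω y / 3)))⁻¹ *
              volume (ball y (wdist Ω y / 3))) * G y := by
              rw [ENNReal.mul_inv_cancel h2 h2', ENNReal.inv_mul_cancel hpos htop, one_mul, one_mul]
          _ = _ := by ring
    _ ≤ 2 ^ d * ∫⁻ x in ball y (wdist Ω y / 3), (volume (ball x (wdist Ω x / 2)))⁻¹ *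
          {z : EuclideanSpace ℝ (Fin d) × EuclideanSpace ℝ (Fin d) |
            dist z.2 z.1 < wdist Ω z.1 / 2}.indicator (fun z => G z.2) (x, y) := by
        gcongr 2 ^ d * ?_
        refine setLIntegral_mono' measurableSet_ball fun x hx => ?_
        rw [mem_ball] at hx
        have h3 := wdist_le_add_dist (Ω := Ω) x y
        have h4 := wdist_le_add_dist (Ω := Ω) y x
        rw [dist_comm y x] at h4
        rw [Set.indicator_of_mem (by
          simp only [mem_ofPred_eq]; rw [dist_comm]; linarith)]
        gcongr ?_⁻¹ * _
        rw [Measure.addHaar_ball_center, Measure.addHaar_ball_center volume y]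
        exact measure_mono (ball_subset_ball (by linarith))
    _ ≤ _ := by
        gcongr

/-- Jensen's inequality for averages over a ball. -/
lemma average_rpow_le {q : ℝ} (hq0 : 0 < q) (hq2 : q ≤ 2) {F : EuclideanSpace ℝ (Fin d) → ℝ}
    (hF : Measurable F) (x : EuclideanSpace ℝ (Fin d)) {r : ℝ} (hr : 0 < r) :
    (volume (ball x r))⁻¹ * ∫⁻ y in ball x r, (‖F y‖₊ : ℝ≥0∞) ^ q ≤
      ((volume (ball x r))⁻¹ * ∫⁻ y in ball x r, (‖F y‖₊ : ℝ≥0∞) ^ (2 : ℕ)) ^ (q / 2) := by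
  have hpos : volume (ball x r) ≠ 0 := (measure_ball_pos _ _ hr).ne'
  have htop : volume (ball x r) ≠ ⊤ := measure_ball_lt_top.ne
  have : IsProbabilityMeasure ((volume (ball x r))⁻¹ • volume.restrict (ball x r)) :=
    ⟨by simp [ENNReal.inv_mul_cancel hpos htop]⟩
  have h := eLpNorm'_le_eLpNorm'_of_exponent_le hq0 hq2
    ((volume (ball x r))⁻¹ • volume.restrict (ball x r)) hF.aestronglyMeasurable
  have h' := ENNReal.rpow_le_rpow h hq0.le
  simp only [eLpNorm', lintegral_smul_measure, ← ENNReal.rpow_mul, smul_eq_mul] at h'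
  rw [one_div_mul_cancel hq0.ne', ENNReal.rpow_one, one_div_mul_eq_div] at h'
  simpa only [← ENNReal.rpow_natCast, Nat.cast_ofNat, enorm_eq_nnnorm] using h'

lemma ofReal_le_mul_ofReal {c a b : ℝ} (hc : 0 ≤ c) (h : a ≤ c * b) :
    ENNReal.ofReal a ≤ ENNReal.ofReal c * ENNReal.ofReal b := by
  rw [← ENNReal.ofReal_mul hc]
  exact ENNReal.ofReal_le_ofReal h

lemma avNorm_rpow {q σ : ℝ} (hq : 0 < q) (H : EuclideanSpace ℝ (Fin d) → ℝ) :
    avNorm q σ Ω H ^ q = ∫⁻ x in Ω,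
      ((volume (Metric.ball x (wdist Ω x / 2)))⁻¹ *
          ∫⁻ y in Metric.ball x (wdist Ω x / 2), (‖H y‖₊ : ℝ≥0∞) ^ (2 : ℕ)) ^ (q / 2) *
        ENNReal.ofReal (wdist Ω x) ^ (q - 1 - q * σ) := by
  rw [avNorm, ← ENNReal.rpow_mul, one_div_mul_cancel hq.ne', ENNReal.rpow_one]

/-- For `q ≤ 2` the averaged norm controls the weighted `L^q` norm. -/
lemma lintegral_rpow_le_avNorm (hd : d ≠ 0) (hΩ : IsOpen Ω) (hne : Ωᶜ.Nonempty) {q : ℝ} (σ : ℝ)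
    (hq0 : 0 < q) (hq2 : q ≤ 2) {F : EuclideanSpace ℝ (Fin d) → ℝ} (hF : Measurable F) :
    ∫⁻ y in Ω, (‖F y‖₊ : ℝ≥0∞) ^ q * ENNReal.ofReal (wdist Ω y) ^ (q - 1 - q * σ) ≤
      2 ^ d * 2 ^ |q - 1 - q * σ| * avNorm q σ Ω F ^ q := by
  have hw := (continuous_wdist (Ω := Ω)).measurable
  refine (lintegral_le_lintegral_average hd hΩ hne (by fun_prop)).trans ?_
  rw [avNorm_rpow hq0, mul_assoc, ← lintegral_const_mul' (2 ^ |q - 1 - q * σ|) _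
    (ENNReal.rpow_ne_top_of_nonneg (abs_nonneg _) (by simp))]
  gcongr 2 ^ d * ?_
  refine setLIntegral_mono' hΩ.measurableSet fun x hx => ?_
  have hdx := wdist_pos hΩ hne hx
  calc _ ≤ (volume (ball x (wdist Ω x / 2)))⁻¹ * ∫⁻ y in ball x (wdist Ω x / 2),
        (‖F y‖₊ : ℝ≥0∞) ^ q *
          (2 ^ |q - 1 - q * σ| * ENNReal.ofReal (wdist Ω x) ^ (q - 1 - q * σ)) := by
        gcongr _ * ?_
        refine setLIntegral_mono' measurableSet_ball fun y hy => ?_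
        rw [mem_ball] at hy
        have h3 := wdist_le_add_dist (Ω := Ω) x y
        have h4 := wdist_le_add_dist (Ω := Ω) y x
        rw [dist_comm x y] at h3
        gcongr _ * ?_
        rw [← ENNReal.ofReal_ofNat 2]
        refine ENNReal.rpow_le_of_comparable (by simp) (by simp) ?_ ?_ _ <;>
          exact ofReal_le_mul_ofReal zero_le_two (by linarith)
    _ = (2 ^ |q - 1 - q * σ| * ENNReal.ofReal (wdist Ω x) ^ (q - 1 - q * σ)) *
        ((volume (ball x (wdist Ω x / 2)))⁻¹ *
          ∫⁻ y in ball x (wdist Ω x / 2), (‖F y‖₊ : ℝ≥0∞) ^ q) := by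
        rw [lintegral_mul_const _ (by fun_prop)]; ring
    _ ≤ (2 ^ |q - 1 - q * σ| * ENNReal.ofReal (wdist Ω x) ^ (q - 1 - q * σ)) * _ :=
        mul_le_mul_right (average_rpow_le hq0 hq2 hF x (by positivity)) _
    _ = _ := by ring

lemma wdist_cone {h : ℝ} (hh0 : 0 < h) {x₀ x : EuclideanSpace ℝ (Fin d)}
    (hx : x ∈ cone Ω h x₀) : (1 + 2 / h)⁻¹ * (wdist Ω x₀ + dist x x₀) ≤ wdist Ω x := by
  have h1 := hx.2
  have h2 := wdist_le_add_dist (Ω := Ω) x₀ x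
  have h3 : (0 : ℝ) < 1 + 2 / h := by positivity
  rw [inv_mul_le_iff₀ h3, add_mul, one_mul, dist_comm x x₀]
  have : 2 / h * wdist Ω x = 2 * (wdist Ω x / h) := by ring
  linarith

lemma measurableSet_cone (hΩ : IsOpen Ω) (h : ℝ) (x₀ : EuclideanSpace ℝ (Fin d)) :
    MeasurableSet (cone Ω h x₀) := by
  refine (hΩ.inter (isOpen_lt (f := fun x => dist x₀ x) (g := fun x => wdist Ω x / h)
    ?_ ?_)).measurableSet
  · fun_prop
  · exact continuous_wdist.div_const _

lemma lintegral_cone_le {h κ : ℝ} (hh0 : 0 < h) (hκ : κ < -d) :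
    ∃ K : ℝ≥0∞, K ≠ ⊤ ∧ ∀ Ω : Set (EuclideanSpace ℝ (Fin d)), IsOpen Ω → Ωᶜ.Nonempty →
      ∀ x₀ ∈ Ω, ∫⁻ x in cone Ω h x₀, ENNReal.ofReal (wdist Ω x) ^ κ ≤
        K * ENNReal.ofReal (wdist Ω x₀) ^ (κ + d) := by
  have hc : 0 < (1 + 2 / h)⁻¹ := by positivity
  have hκ0 : κ < 0 := hκ.trans_le (by simp)
  refine ⟨ENNReal.ofReal (1 + 2 / h)⁻¹ ^ κ * ∫⁻ x : EuclideanSpace ℝ (Fin d),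
    ENNReal.ofReal ((1 + ‖x‖) ^ κ), ENNReal.mul_ne_top ?_ ?_, ?_⟩
  · exact ENNReal.rpow_ne_top_of_ne_zero (by simpa using hc) (by simp)
  · have := finite_integral_one_add_norm (E := EuclideanSpace ℝ (Fin d)) (μ := volume) (r := -κ)
      (by rw [finrank_euclideanSpace_fin]; linarith)
    simpa using this.ne
  intro Ω hΩ hne x₀ hx₀
  have hδ := wdist_pos hΩ hne hx₀
  have hD0 : ENNReal.ofReal (wdist Ω x₀) ≠ 0 := by simpa using hδ
  set δ := wdist Ω x₀ with hδdef
  have hscale : ∫⁻ x, ENNReal.ofReal ((1 + ‖δ⁻¹ • (x - x₀)‖) ^ κ) =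
      ENNReal.ofReal δ ^ d * ∫⁻ x : EuclideanSpace ℝ (Fin d), ENNReal.ofReal ((1 + ‖x‖) ^ κ) := by
    have hm : Measurable fun x : EuclideanSpace ℝ (Fin d) => ENNReal.ofReal ((1 + ‖x‖) ^ κ) := by
      fun_prop
    rw [lintegral_sub_right_eq_self (fun x => ENNReal.ofReal ((1 + ‖δ⁻¹ • x‖) ^ κ)) x₀,
      ← lintegral_map (f := fun x => ENNReal.ofReal ((1 + ‖x‖) ^ κ)) hm
        (measurable_const_smul δ⁻¹),
      Measure.map_addHaar_smul volume (inv_ne_zero hδ.ne'), lintegral_smul_measure,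
      finrank_euclideanSpace_fin, inv_pow, inv_inv, abs_of_pos (by positivity),
      ENNReal.ofReal_pow hδ.le, smul_eq_mul]
  calc _ ≤ ∫⁻ x in cone Ω h x₀, (ENNReal.ofReal (1 + 2 / h)⁻¹ ^ κ * ENNReal.ofReal δ ^ κ) *
        ENNReal.ofReal ((1 + ‖δ⁻¹ • (x - x₀)‖) ^ κ) := by
        refine setLIntegral_mono' (measurableSet_cone hΩ h x₀) fun x hx => ?_
        have h1 := wdist_cone hh0 hx
        have h2 : (1 + 2 / h)⁻¹ * (δ + dist x x₀)
            = (1 + 2 / h)⁻¹ * δ * (1 + ‖δ⁻¹ • (x - x₀)‖) := by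
          rw [norm_smul, Real.norm_of_nonneg (inv_nonneg.2 hδ.le), dist_eq_norm]
          field_simp
        rw [← hδdef, h2] at h1
        have h3 : (0 : ℝ) < 1 + ‖δ⁻¹ • (x - x₀)‖ := by positivity
        refine (ENNReal.rpow_le_rpow_of_le_of_nonpos
          (ENNReal.ofReal_le_ofReal h1) hκ0.le).trans_eq ?_
        rw [ENNReal.ofReal_mul (by positivity), ENNReal.ofReal_mul hc.le,
          ENNReal.mul_rpow_of_ne_top (ENNReal.mul_ne_top (by simp) (by simp)) (by simp),
          ENNReal.mul_rpow_of_ne_top (by simp) (by simp), ENNReal.ofReal_rpow_of_pos h3]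
    _ ≤ ∫⁻ x, (ENNReal.ofReal (1 + 2 / h)⁻¹ ^ κ * ENNReal.ofReal δ ^ κ) *
        ENNReal.ofReal ((1 + ‖δ⁻¹ • (x - x₀)‖) ^ κ) := setLIntegral_le_lintegral _ _
    _ = _ := by
        rw [lintegral_const_mul _ (by fun_prop), hscale, ENNReal.rpow_add _ _ hD0 (by simp),
          ENNReal.rpow_natCast]
        ring

/-- Averages of a function supported in the Whitney ball at `x₀` vanish away from `x₀`. -/
lemma comparable_of_average_ne_zero
    {x₀ x : EuclideanSpace ℝ (Fin d)} {Φ : EuclideanSpace ℝ (Fin d) → ℝ}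
    (hsupp : Function.support Φ ⊆ ball x₀ (wdist Ω x₀ / 2))
    (hx : (volume (ball x (wdist Ω x / 2)))⁻¹ *
      ∫⁻ y in ball x (wdist Ω x / 2), (‖Φ y‖₊ : ℝ≥0∞) ^ (2 : ℕ) ≠ 0) :
    wdist Ω x ≤ 3 * wdist Ω x₀ ∧ wdist Ω x₀ ≤ 3 * wdist Ω x ∧ dist x x₀ < 2 * wdist Ω x₀ := by
  have h1 := right_ne_zero_of_mul hx
  obtain ⟨y, hy, hyne⟩ : ∃ y ∈ ball x (wdist Ω x / 2), Φ y ≠ 0 := by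
    by_contra! hcon
    refine h1 (setLIntegral_eq_zero measurableSet_ball fun y hy => ?_)
    simp [hcon y hy]
  have hy' := hsupp hyne
  rw [mem_ball] at hy hy'
  have h2 := dist_triangle_left x x₀ y
  have h3 := wdist_le_add_dist (Ω := Ω) x₀ x
  have h4 := wdist_le_add_dist (Ω := Ω) x x₀
  rw [dist_comm x₀ x] at h3
  refine ⟨by linarith, by linarith, by linarith⟩

lemma average_le_of_support (hd : d ≠ 0) (hΩ : IsOpen Ω) (hne : Ωᶜ.Nonempty)
    {x₀ : EuclideanSpace ℝ (Fin d)} {Φ : EuclideanSpace ℝ (Fin d) → ℝ}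
    (hx₀ : x₀ ∈ Ω)
    (hsupp : Function.support Φ ⊆ ball x₀ (wdist Ω x₀ / 2)) (x : EuclideanSpace ℝ (Fin d)) :
    (volume (ball x (wdist Ω x / 2)))⁻¹ *
      ∫⁻ y in ball x (wdist Ω x / 2), (‖Φ y‖₊ : ℝ≥0∞) ^ (2 : ℕ) ≤
    6 ^ d * ((volume (ball x₀ (wdist Ω x₀)))⁻¹ * ∫⁻ y, (‖Φ y‖₊ : ℝ≥0∞) ^ (2 : ℕ)) := by
  by_cases hx : (volume (ball x (wdist Ω x / 2)))⁻¹ *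
      ∫⁻ y in ball x (wdist Ω x / 2), (‖Φ y‖₊ : ℝ≥0∞) ^ (2 : ℕ) = 0
  · rw [hx]; exact zero_le
  have h := comparable_of_average_ne_zero hsupp hx
  have hv : volume (ball x₀ (wdist Ω x₀)) ≤ 6 ^ d * volume (ball x (wdist Ω x / 2)) := by
    rw [← ENNReal.ofReal_ofNat 6, ← volume_ball_mul hd x₀ x (by norm_num)]
    exact measure_mono (ball_subset_ball (by linarith [h.2.1]))
  rw [← mul_assoc]
  gcongr ?_ * ?_
  · rw [← div_eq_mul_inv, ENNReal.le_div_iff_mul_le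
      (.inl (measure_ball_pos _ _ (wdist_pos hΩ hne hx₀)).ne') (.inl measure_ball_lt_top.ne),
      mul_comm, ← div_eq_mul_inv]
    exact ENNReal.div_le_of_le_mul hv
  · exact setLIntegral_le_lintegral _ _

lemma avNorm_rpow_le_of_support (hd : d ≠ 0) (hΩ : IsOpen Ω) (hne : Ωᶜ.Nonempty)
    {x₀ : EuclideanSpace ℝ (Fin d)} {Φ : EuclideanSpace ℝ (Fin d) → ℝ} (hx₀ : x₀ ∈ Ω)
    (hsupp : Function.support Φ ⊆ ball x₀ (wdist Ω x₀ / 2)) {q : ℝ} (hq : 0 < q) (σ : ℝ) :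
    avNorm q σ Ω Φ ^ q ≤ ((6 ^ d) ^ (q / 2) * 3 ^ |q - 1 - q * σ| * 2 ^ d) *
      (((volume (ball x₀ (wdist Ω x₀)))⁻¹ * ∫⁻ y, (‖Φ y‖₊ : ℝ≥0∞) ^ (2 : ℕ)) ^ (q / 2) *
        ENNReal.ofReal (wdist Ω x₀) ^ (q - 1 - q * σ) * volume (ball x₀ (wdist Ω x₀))) := by
  rw [avNorm_rpow hq]
  set e := (volume (ball x₀ (wdist Ω x₀)))⁻¹ * ∫⁻ y, (‖Φ y‖₊ : ℝ≥0∞) ^ (2 : ℕ)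
  set a := q - 1 - q * σ
  have hq' : 0 < q / 2 := by positivity
  calc _ ≤ ∫⁻ x, (ball x₀ (2 * wdist Ω x₀)).indicator (fun _ => (6 ^ d * e) ^ (q / 2) *
        (3 ^ |a| * ENNReal.ofReal (wdist Ω x₀) ^ a)) x := by
        refine (setLIntegral_le_lintegral _ _).trans (lintegral_mono fun x => ?_)
        by_cases hx : (volume (ball x (wdist Ω x / 2)))⁻¹ *
            ∫⁻ y in ball x (wdist Ω x / 2), (‖Φ y‖₊ : ℝ≥0∞) ^ (2 : ℕ) = 0
        · simp only [hx, ENNReal.zero_rpow_of_pos hq', zero_mul]; exact zero_le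
        obtain ⟨h1, h2, h3⟩ := comparable_of_average_ne_zero hsupp hx
        rw [Set.indicator_of_mem (mem_ball.2 h3)]
        gcongr ?_ * ?_
        · exact ENNReal.rpow_le_rpow (average_le_of_support hd hΩ hne hx₀ hsupp x) hq'.le
        · rw [← ENNReal.ofReal_ofNat 3]
          exact ENNReal.rpow_le_of_comparable (by simp) (by simp)
            (ofReal_le_mul_ofReal (by norm_num) h1) (ofReal_le_mul_ofReal (by norm_num) h2) _
    _ = _ := by
        rw [lintegral_indicator measurableSet_ball, setLIntegral_const,
          volume_ball_mul hd x₀ x₀ zero_le_two, ENNReal.mul_rpow_of_nonneg _ _ hq'.le,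
          ENNReal.ofReal_ofNat]
        ring

lemma le_avNorm_rpow_of_support (hd : d ≠ 0) (hΩ : IsOpen Ω) (hne : Ωᶜ.Nonempty)
    {x₀ : EuclideanSpace ℝ (Fin d)} {Φ : EuclideanSpace ℝ (Fin d) → ℝ} (hx₀ : x₀ ∈ Ω)
    (hΦ : Measurable Φ) (hΦ2 : ∫⁻ y, (‖Φ y‖₊ : ℝ≥0∞) ^ (2 : ℕ) ≠ ⊤)
    (hsupp : Function.support Φ ⊆ ball x₀ (wdist Ω x₀ / 2)) {p : ℝ} (hp : 0 < p) (hp1 : p ≤ 1)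
    (s : ℝ) :
    ((volume (ball x₀ (wdist Ω x₀)))⁻¹ * ∫⁻ y, (‖Φ y‖₊ : ℝ≥0∞) ^ (2 : ℕ)) ^ (p / 2) *
        ENNReal.ofReal (wdist Ω x₀) ^ (p - 1 - p * s) * volume (ball x₀ (wdist Ω x₀)) ≤
      (2 ^ d * 3 ^ |p - 1 - p * s| * (6 ^ d) ^ (1 - p / 2)) * avNorm p s Ω Φ ^ p := by
  have hδ := wdist_pos hΩ hne hx₀
  have hV0 : volume (ball x₀ (wdist Ω x₀)) ≠ 0 := (measure_ball_pos _ _ hδ).ne'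
  have hVt : volume (ball x₀ (wdist Ω x₀)) ≠ ⊤ := measure_ball_lt_top.ne
  have hp' : 0 < p / 2 := by positivity
  have hp'' : 0 < 1 - p / 2 := by linarith
  have hint : ∫⁻ y, (‖Φ y‖₊ : ℝ≥0∞) ^ (2 : ℕ) = ∫⁻ y in Ω, (‖Φ y‖₊ : ℝ≥0∞) ^ (2 : ℕ) := by
    rw [setLIntegral_eq_of_support_subset]
    intro y hy
    have hy' : Φ y ≠ 0 := by
      intro h0; simp [h0] at hy
    have h1 := hsupp hy'
    rw [mem_ball, dist_comm] at h1
    exact mem_of_wdist_pos (by linarith [wdist_le_add_dist (Ω := Ω) x₀ y])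
  rw [avNorm_rpow hp]
  have havg := lintegral_le_lintegral_average hd hΩ hne
    (G := fun y => (‖Φ y‖₊ : ℝ≥0∞) ^ (2 : ℕ)) (by fun_prop)
  rw [← hint] at havg
  set E := ∫⁻ y, (‖Φ y‖₊ : ℝ≥0∞) ^ (2 : ℕ)
  set V := volume (ball x₀ (wdist Ω x₀))
  set a := p - 1 - p * s
  set A := fun x => (volume (ball x (wdist Ω x / 2)))⁻¹ *
      ∫⁻ y in ball x (wdist Ω x / 2), (‖Φ y‖₊ : ℝ≥0∞) ^ (2 : ℕ) with hA
  have hA6 : ∀ x, A x ≤ 6 ^ d * (V⁻¹ * E) := average_le_of_support hd hΩ hne hx₀ hsupp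
  have het : V⁻¹ * E ≠ ⊤ := ENNReal.mul_ne_top (by simpa using hV0) hΦ2
  have hAt : ∀ x, A x ≠ ⊤ := fun x =>
    ((hA6 x).trans_lt (ENNReal.mul_lt_top (by simp) het.lt_top)).ne
  by_cases he : V⁻¹ * E = 0
  · simp [he, ENNReal.zero_rpow_of_pos hp']
  have hE : E = V * (V⁻¹ * E) := by
    rw [← mul_assoc, ENNReal.mul_inv_cancel hV0 hVt, one_mul]
  have key : E * ENNReal.ofReal (wdist Ω x₀) ^ a ≤ (V⁻¹ * E) ^ (1 - p / 2) *
      ((2 ^ d * 3 ^ |a| * (6 ^ d) ^ (1 - p / 2)) *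
        ∫⁻ x in Ω, A x ^ (p / 2) * ENNReal.ofReal (wdist Ω x) ^ a) := by
    calc _ ≤ 2 ^ d * (∫⁻ x in Ω, A x) * ENNReal.ofReal (wdist Ω x₀) ^ a := by gcongr
      _ = 2 ^ d * ∫⁻ x in Ω, A x * ENNReal.ofReal (wdist Ω x₀) ^ a := by
          rw [lintegral_mul_const' _ _
            (ENNReal.rpow_ne_top_of_ne_zero (by simpa using hδ) (by simp))]
          ring
      _ ≤ 2 ^ d * ∫⁻ x in Ω, (3 ^ |a| * (6 ^ d * (V⁻¹ * E)) ^ (1 - p / 2)) *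
            (A x ^ (p / 2) * ENNReal.ofReal (wdist Ω x) ^ a) := by
          gcongr 2 ^ d * ?_
          refine lintegral_mono fun x => ?_
          by_cases hx : A x = 0
          · simp [hx]
          obtain ⟨h1, h2, h3⟩ := comparable_of_average_ne_zero hsupp hx
          have hw : ENNReal.ofReal (wdist Ω x₀) ^ a ≤
              3 ^ |a| * ENNReal.ofReal (wdist Ω x) ^ a := by
            rw [← ENNReal.ofReal_ofNat 3]
            exact ENNReal.rpow_le_of_comparable (by simp) (by simp)
              (ofReal_le_mul_ofReal (by norm_num) h2) (ofReal_le_mul_ofReal (by norm_num) h1) _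
          calc A x * ENNReal.ofReal (wdist Ω x₀) ^ a
              = A x ^ (1 - p / 2) * A x ^ (p / 2) * ENNReal.ofReal (wdist Ω x₀) ^ a := by
                rw [← ENNReal.rpow_add _ _ hx (hAt x), sub_add_cancel, ENNReal.rpow_one]
            _ ≤ (6 ^ d * (V⁻¹ * E)) ^ (1 - p / 2) * A x ^ (p / 2) *
                  (3 ^ |a| * ENNReal.ofReal (wdist Ω x) ^ a) := by
                gcongr
                exact hA6 x
            _ = _ := by ring
      _ = _ := by
          rw [lintegral_const_mul' _ _ (ENNReal.mul_ne_top
            (ENNReal.rpow_ne_top_of_nonneg (abs_nonneg _) (by simp))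
            (ENNReal.rpow_ne_top_of_nonneg hp''.le (ENNReal.mul_ne_top (by simp) het))),
            ENNReal.mul_rpow_of_nonneg _ _ hp''.le]
          ring
  have hsplit : E = (V⁻¹ * E) ^ (1 - p / 2) * ((V⁻¹ * E) ^ (p / 2) * V) := by
    rw [← mul_assoc, ← ENNReal.rpow_add _ _ he het, sub_add_cancel, ENNReal.rpow_one, mul_comm]
    exact hE
  have hlhs : E * ENNReal.ofReal (wdist Ω x₀) ^ a = (V⁻¹ * E) ^ (1 - p / 2) *
      ((V⁻¹ * E) ^ (p / 2) * ENNReal.ofReal (wdist Ω x₀) ^ a * V) := by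
    conv_lhs => rw [hsplit]
    ring
  rw [hlhs] at key
  exact (ENNReal.mul_le_mul_iff_right
    (ENNReal.rpow_pos (pos_iff_ne_zero.2 he) het).ne'
    (ENNReal.rpow_ne_top_of_nonneg hp''.le het)).1 key

end Helpers

theorem cone_estimate (d : ℕ) (hd : 2 ≤ d) (σm s p qm h C₀ : ℝ)
    (hσ0 : 0 < σm) (hσs : σm < s) (hs1 : s < 1)
    (hp0 : 0 < p) (hp1 : p ≤ 1) (hq1 : 1 < qm) (hq2 : qm ≤ 2)
    (hslope : σm - (d - 1 : ℝ) / qm < s - (d - 1 : ℝ) / p)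
    (hh0 : 0 < h) (hh1 : h < 1) (hC₀ : 0 < C₀) :
    ∃ C : ℝ, 0 < C ∧
      ∀ Ω : Set (EuclideanSpace ℝ (Fin d)), IsOpen Ω → Ωᶜ.Nonempty →
      ∀ x₀ ∈ Ω, ∀ Φ : EuclideanSpace ℝ (Fin d) → ℝ, Measurable Φ →
        (∫⁻ y, (‖Φ y‖₊ : ℝ≥0∞) ^ (2 : ℕ)) < ⊤ →
        Function.support Φ ⊆ Metric.ball x₀ (wdist Ω x₀ / 2) →
      ∀ F : EuclideanSpace ℝ (Fin d) → ℝ, Measurable F →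
        avNorm qm σm Ω F ≤ ENNReal.ofReal C₀ * avNorm qm σm Ω Φ →
        (∫⁻ x in cone Ω h x₀,
            (‖F x‖₊ : ℝ≥0∞) ^ p * ENNReal.ofReal (wdist Ω x) ^ (p - 1 - p * s)) ≤
          ENNReal.ofReal C * (avNorm p s Ω Φ) ^ p := by
  have hd0 : d ≠ 0 := by omega
  have hq0 : 0 < qm := by linarith
  have hr0 : 0 < p / qm := by positivity
  have hr1 : p / qm < 1 := by rw [div_lt_one hq0]; linarith
  have ht0 : 0 < 1 - p / qm := by linarith
  have hqr : qm * (p / qm) = p := by field_simp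
  set r := p / qm with hr
  set t := 1 - r with ht
  set a := qm - 1 - qm * σm with ha
  set b := p - 1 - p * s with hb
  set κ := (b - a * r) / t with hκdef
  have hκt : κ * t = b - a * r := by rw [hκdef]; field_simp
  have hκ : κ < -d := by
    rw [hκdef, div_lt_iff₀ ht0]
    have h1 : a * r = p - r - p * σm := by
      rw [ha]; linear_combination (1 - σm) * hqr
    have h2 : p * (σm - (d - 1 : ℝ) / qm) < p * (s - (d - 1 : ℝ) / p) :=
      mul_lt_mul_of_pos_left hslope hp0
    have h3 : p * (σm - (d - 1 : ℝ) / qm) = p * σm - (d - 1) * r := by rw [hr]; ring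
    have h4 : p * (s - (d - 1 : ℝ) / p) = p * s - (d - 1) := by field_simp
    rw [h3, h4] at h2
    rw [h1, hb, ht]
    linarith
  obtain ⟨K₃, hK₃, hcone⟩ := lintegral_cone_le (d := d) hh0 hκ
  set ω := volume (ball (0 : EuclideanSpace ℝ (Fin d)) 1)
  have hω0 : ω ≠ 0 := (measure_ball_pos _ _ one_pos).ne'
  have hωt : ω ≠ ⊤ := measure_ball_lt_top.ne
  set K₂ : ℝ≥0∞ := 2 ^ d * 2 ^ |a| with hK₂
  set K₄ : ℝ≥0∞ := (6 ^ d) ^ (qm / 2) * 3 ^ |a| * 2 ^ d with hK₄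
  set K₅ : ℝ≥0∞ := 2 ^ d * 3 ^ |b| * (6 ^ d) ^ (1 - p / 2) with hK₅
  set K : ℝ≥0∞ := (K₂ * (ENNReal.ofReal C₀ ^ qm * K₄)) ^ r * (K₃ * ω⁻¹) ^ t * K₅ with hK
  have hKt : K ≠ ⊤ := by
    have hpow : ∀ x y : ℝ, 0 ≤ y → ENNReal.ofReal x ^ y ≠ ⊤ := fun x y hy =>
      ENNReal.rpow_ne_top_of_nonneg hy (by simp)
    have h2 : (2 : ℝ≥0∞) ^ |a| ≠ ⊤ := ENNReal.rpow_ne_top_of_nonneg (abs_nonneg _) (by simp)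
    have h3 : ∀ u : ℝ, (3 : ℝ≥0∞) ^ |u| ≠ ⊤ := fun u =>
      ENNReal.rpow_ne_top_of_nonneg (abs_nonneg _) (by simp)
    have h6 : ∀ u : ℝ, 0 ≤ u → ((6 : ℝ≥0∞) ^ d) ^ u ≠ ⊤ := fun u hu =>
      ENNReal.rpow_ne_top_of_nonneg hu (by simp)
    have h2d : (2 : ℝ≥0∞) ^ d ≠ ⊤ := by simp
    refine ENNReal.mul_ne_top (ENNReal.mul_ne_top
      (ENNReal.rpow_ne_top_of_nonneg hr0.le ?_) (ENNReal.rpow_ne_top_of_nonneg ht0.le ?_)) ?_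
    · exact ENNReal.mul_ne_top (ENNReal.mul_ne_top h2d h2) (ENNReal.mul_ne_top (hpow _ _ hq0.le)
        (ENNReal.mul_ne_top (ENNReal.mul_ne_top (h6 _ (by positivity)) (h3 _)) h2d))
    · exact ENNReal.mul_ne_top hK₃ (by simpa using hω0)
    · exact ENNReal.mul_ne_top (ENNReal.mul_ne_top h2d (h3 _)) (h6 _ (by linarith))
  refine ⟨K.toReal + 1, by positivity, ?_⟩
  intro Ω hΩ hne x₀ hx₀ Φ hΦ hΦ2 hsupp F hF hFΦ
  have hKle : K ≤ ENNReal.ofReal (K.toReal + 1) := by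
    rw [← ENNReal.ofReal_toReal hKt]
    exact ENNReal.ofReal_le_ofReal (by simp)
  refine le_trans ?_ (mul_le_mul_left hKle _)
  have hw := (continuous_wdist (Ω := Ω)).measurable
  have hδ := wdist_pos hΩ hne hx₀
  have hD0 : ENNReal.ofReal (wdist Ω x₀) ≠ 0 := by simpa using hδ
  have hF' := lintegral_rpow_le_avNorm hd0 hΩ hne σm hq0 hq2 hF
  have hup := avNorm_rpow_le_of_support hd0 hΩ hne hx₀ hsupp hq0 σm
  have hlow := le_avNorm_rpow_of_support hd0 hΩ hne hx₀ hΦ hΦ2.ne hsupp hp0 hp1 s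
  have hcone' := hcone Ω hΩ hne x₀ hx₀
  rw [← ha, ← hK₂] at hF'
  rw [← ha, ← hK₄] at hup
  rw [← hb, ← hK₅] at hlow
  have hV : volume (ball x₀ (wdist Ω x₀)) = ENNReal.ofReal (wdist Ω x₀) ^ d * ω := by
    rw [← volume_ball_mul hd0 x₀ 0 hδ.le, mul_one]
  set D := ENNReal.ofReal (wdist Ω x₀) with hD
  have hDt : D ≠ ⊤ := by simp [hD]
  set V := volume (ball x₀ (wdist Ω x₀))
  have hV0 : V ≠ 0 := (measure_ball_pos _ _ hδ).ne'
  have hVt : V ≠ ⊤ := measure_ball_lt_top.ne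
  set e := V⁻¹ * ∫⁻ y, (‖Φ y‖₊ : ℝ≥0∞) ^ (2 : ℕ)
  have hpowers : (e ^ (qm / 2) * D ^ a * V) ^ r * (D ^ (κ + d)) ^ t
      = (ω⁻¹) ^ t * (e ^ (p / 2) * D ^ b * V) := by
    have h1 : D ^ (d : ℝ) = V * ω⁻¹ := by
      rw [ENNReal.rpow_natCast, hV, mul_assoc, ENNReal.mul_inv_cancel hω0 hωt, mul_one]
    have h2 : (D ^ (κ + d)) ^ t = D ^ (b - a * r) * (V ^ t * (ω⁻¹) ^ t) := by
      rw [ENNReal.rpow_add _ _ hD0 hDt, ENNReal.mul_rpow_of_nonneg _ _ ht0.le,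
        ← ENNReal.rpow_mul, hκt, h1, ENNReal.mul_rpow_of_nonneg _ _ ht0.le]
    have h3 : (e ^ (qm / 2) * D ^ a * V) ^ r = e ^ (p / 2) * D ^ (a * r) * V ^ r := by
      rw [ENNReal.mul_rpow_of_nonneg _ _ hr0.le, ENNReal.mul_rpow_of_nonneg _ _ hr0.le,
        ← ENNReal.rpow_mul, ← ENNReal.rpow_mul, div_mul_eq_mul_div, hqr]
    have h4 : D ^ b = D ^ (a * r) * D ^ (b - a * r) := by
      rw [← ENNReal.rpow_add _ _ hD0 hDt, add_sub_cancel]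
    have h5 : V = V ^ r * V ^ t := by
      rw [← ENNReal.rpow_add _ _ hV0 hVt, ht, add_sub_cancel, ENNReal.rpow_one]
    rw [h2, h3, h4]
    conv_rhs => rw [h5]
    ring
  calc _ = ∫⁻ x in cone Ω h x₀, ((‖F x‖₊ : ℝ≥0∞) ^ qm * ENNReal.ofReal (wdist Ω x) ^ a) ^ r *
        (ENNReal.ofReal (wdist Ω x) ^ κ) ^ t := by
        refine setLIntegral_congr_fun (measurableSet_cone hΩ h x₀) fun x hx => ?_
        have hx0 : ENNReal.ofReal (wdist Ω x) ≠ 0 := by simpa using wdist_pos hΩ hne hx.1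
        rw [ENNReal.mul_rpow_of_nonneg _ _ hr0.le, ← ENNReal.rpow_mul, ← ENNReal.rpow_mul,
          ← ENNReal.rpow_mul, hqr, hκt, mul_assoc, ← ENNReal.rpow_add _ _ hx0 (by simp),
          add_sub_cancel]
    _ ≤ (∫⁻ x in cone Ω h x₀, (‖F x‖₊ : ℝ≥0∞) ^ qm * ENNReal.ofReal (wdist Ω x) ^ a) ^ r *
        (∫⁻ x in cone Ω h x₀, ENNReal.ofReal (wdist Ω x) ^ κ) ^ t :=
        ENNReal.lintegral_mul_norm_pow_le (by fun_prop) (by fun_prop) hr0.le ht0.le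
          (by rw [ht]; ring)
    _ ≤ (K₂ * (ENNReal.ofReal C₀ ^ qm * (K₄ * (e ^ (qm / 2) * D ^ a * V)))) ^ r *
        (K₃ * D ^ (κ + d)) ^ t := by
        gcongr ?_ ^ r * ?_ ^ t
        refine (lintegral_mono_set fun x hx => hx.1).trans (hF'.trans ?_)
        gcongr K₂ * ?_
        refine (ENNReal.rpow_le_rpow hFΦ hq0.le).trans ?_
        rw [ENNReal.mul_rpow_of_nonneg _ _ hq0.le]
        gcongr
    _ = (K₂ * (ENNReal.ofReal C₀ ^ qm * K₄)) ^ r * K₃ ^ t *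
        ((e ^ (qm / 2) * D ^ a * V) ^ r * (D ^ (κ + d)) ^ t) := by
        rw [← mul_assoc _ K₄, ← mul_assoc K₂, ENNReal.mul_rpow_of_nonneg _ _ hr0.le,
          ENNReal.mul_rpow_of_nonneg K₃ _ ht0.le]
        ring
    _ = (K₂ * (ENNReal.ofReal C₀ ^ qm * K₄)) ^ r * (K₃ * ω⁻¹) ^ t *
        (e ^ (p / 2) * D ^ b * V) := by
        rw [hpowers, ENNReal.mul_rpow_of_nonneg K₃ _ ht0.le]
        ring
    _ ≤ (K₂ * (ENNReal.ofReal C₀ ^ qm * K₄)) ^ r * (K₃ * ω⁻¹) ^ t *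
        (K₅ * avNorm p s Ω Φ ^ p) := by gcongr
    _ = _ := by rw [hK]; ring
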